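/- For every triple 𝔐=(m_c,m_r,m_z) of nonnegative integers there exist integers C², C³, C⁴ (indexed respectively by triples 𝔑≤𝔐 with 1≤|𝔑|≤|𝔐|, triples 𝔑≤𝔐 with 0≤|𝔑|≤|𝔐|−1, and pairs 𝔏=(l_r,l_z) with l_r≤m_r, l_z≤m_z, 1≤l_r+l_z≤m_r+m_z) such that the following holds: for every smooth divergence-free vector field u : ℝ³ → ℝ³ with cylindrical components u_r, u_θ, u_z, and every smooth axisymmetric f : ℝ³ → ℝ, on U one has 𝒟^𝔐((u_r∂_r+u_z∂_z)f) − (u_r∂_r+u_z∂_z)(𝒟^𝔐 f) = Σ_{1≤|𝔑|≤|𝔐|} C²_𝔑 (𝒟^𝔑 u_z)(𝒟^{𝔐−𝔑}∂_z f) + Σ_{0≤|𝔑|≤|𝔐|−1} C³_𝔑 (𝒟^𝔑((1/r)∂_θ u_θ + ∂_z u_z))(𝒟^{𝔐−𝔑} f) + Σ_{1≤l_r+l_z≤m_r+m_z} C⁴_𝔏 (∂_z^{l_z}∂_r^{l_r} u_r)(∂_r 𝒟^{𝔐−(0,l_r,l_z)} f). -/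

import Mathlib

open MeasureTheory

noncomputable section

abbrev R3 : Type := Fin 3 → ℝ

/-- cylindrical radius `r(x) = √(x₁² + x₂²)` -/
def rr (x : R3) : ℝ := Real.sqrt (x 0 ^ 2 + x 1 ^ 2)

/-- the region off the symmetry axis -/
def U : Set R3 := {x | 0 < rr x}

/-- partial derivative in coordinate direction `i` -/
def pd (i : Fin 3) (u : R3 → ℝ) : R3 → ℝ := fun x => fderiv ℝ u x (Pi.single i 1)

/-- angular derivative `∂_θ u = x₁ ∂₂ u − x₂ ∂₁ u` -/
def dTheta (u : R3 → ℝ) : R3 → ℝ := fun x => x 0 * pd 1 u x - x 1 * pd 0 u x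

/-- radial derivative `∂_r u = (x₁ ∂₁ u + x₂ ∂₂ u)/r` -/
def dR (u : R3 → ℝ) : R3 → ℝ := fun x => (x 0 * pd 0 u x + x 1 * pd 1 u x) / rr x

/-- vertical derivative `∂_z` -/
def dZ (u : R3 → ℝ) : R3 → ℝ := pd 2 u

/-- the operator `(1/r)∂_r` -/
def dRr (u : R3 → ℝ) : R3 → ℝ := fun x => dR u x / rr x

/-- axisymmetric: `∂_θ f = 0` on `U` -/
def axisym (f : R3 → ℝ) : Prop := ∀ x ∈ U, dTheta f x = 0

/-- radial unit vector -/
def er (x : R3) : R3 := ![x 0 / rr x, x 1 / rr x, 0]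
/-- azimuthal unit vector -/
def etheta (x : R3) : R3 := ![-(x 1) / rr x, x 0 / rr x, 0]
/-- vertical unit vector -/
def ez : R3 := ![0, 0, 1]

/-- Euclidean dot product on `ℝ³` -/
def dot (a b : R3) : ℝ := ∑ j : Fin 3, a j * b j

/-- radial cylindrical component `u_r = u · e_r` -/
def compR (u : R3 → R3) : R3 → ℝ := fun y => dot (u y) (er y)
/-- azimuthal cylindrical component `u_θ = u · e_θ` -/
def compTh (u : R3 → R3) : R3 → ℝ := fun y => dot (u y) (etheta y)
/-- vertical cylindrical component `u_z = u · e_z` -/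
def compZ (u : R3 → R3) : R3 → ℝ := fun y => dot (u y) ez

/-- divergence-free vector field -/
def divFree (u : R3 → R3) : Prop := ∀ x : R3, (∑ i : Fin 3, pd i (fun y => u y i) x) = 0

/-- the compound cylindrical derivative `𝒟^𝔐 = ∂_z^{m_z} ∘ ∂_r^{m_r} ∘ ((1/r)∂_r)^{m_c}` -/
def Dop (mc mr mz : ℕ) (f : R3 → ℝ) : R3 → ℝ := dZ^[mz] (dR^[mr] (dRr^[mc] f))

/-- multi-indices `𝔑 ≤ 𝔐` componentwise with `1 ≤ |𝔑|` -/
def idx1 (mc mr mz : ℕ) : Finset (ℕ × ℕ × ℕ) :=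
  (Finset.range (mc + 1) ×ˢ Finset.range (mr + 1) ×ˢ Finset.range (mz + 1)).filter
    (fun p => 1 ≤ 2 * p.1 + p.2.1 + p.2.2)

/-- multi-indices `𝔑 ≤ 𝔐` componentwise with `|𝔑| ≤ |𝔐| − 1` -/
def idx2 (mc mr mz : ℕ) : Finset (ℕ × ℕ × ℕ) :=
  (Finset.range (mc + 1) ×ˢ Finset.range (mr + 1) ×ˢ Finset.range (mz + 1)).filter
    (fun p => 2 * p.1 + p.2.1 + p.2.2 < 2 * mc + mr + mz)

/-- pairs `𝔏 = (l_r, l_z)` with `l_r ≤ m_r`, `l_z ≤ m_z`, `1 ≤ l_r + l_z` -/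
def idx3 (mr mz : ℕ) : Finset (ℕ × ℕ) :=
  (Finset.range (mr + 1) ×ˢ Finset.range (mz + 1)).filter (fun p => 1 ≤ p.1 + p.2)

/-- smooth on `U` -/
def Sm (f : R3 → ℝ) : Prop := ContDiffOn ℝ (⊤ : ℕ∞) f U

/-- local linear operators on functions smooth on `U` -/
structure LinOp (D : (R3 → ℝ) → (R3 → ℝ)) : Prop where
  sm : ∀ f, Sm f → Sm (D f)
  congr : ∀ f g, Set.EqOn f g U → Set.EqOn (D f) (D g) U
  add : ∀ f g, Sm f → Sm g → Set.EqOn (D (f + g)) (D f + D g) U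
  smul : ∀ (c : ℝ) f, Sm f → Set.EqOn (D (c • f)) (c • D f) U

/-- local derivations on functions smooth on `U` -/
structure Good (D : (R3 → ℝ) → (R3 → ℝ)) : Prop extends LinOp D where
  mul : ∀ f g, Sm f → Sm g → Set.EqOn (D (f * g)) (D f * g + f * D g) U

theorem rr_cont : Continuous rr := by
  unfold rr; fun_prop

theorem U_open : IsOpen U := isOpen_lt continuous_const rr_cont

theorem Sm.add {f g} (hf : Sm f) (hg : Sm g) : Sm (f + g) := ContDiffOn.add hf hg
theorem Sm.mul {f g} (hf : Sm f) (hg : Sm g) : Sm (f * g) := ContDiffOn.mul hf hg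
theorem Sm.smul {f} (c : ℝ) (hf : Sm f) : Sm (c • f) := ContDiffOn.const_smul c hf
theorem Sm.sum {ι : Type} (s : Finset ι) (F : ι → R3 → ℝ) (h : ∀ i ∈ s, Sm (F i)) :
    Sm (∑ i ∈ s, F i) := by
  classical
  induction s using Finset.induction_on with
  | empty => exact (contDiffOn_const : ContDiffOn ℝ (⊤ : ℕ∞) (fun _ : R3 => (0:ℝ)) U)
  | insert a s ha ih =>
    rw [Finset.sum_insert ha]
    exact (h a (Finset.mem_insert_self _ _)).add (ih fun i hi => h i (Finset.mem_insert_of_mem hi))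

theorem Sm.congr {f g} (hf : Sm f) (h : Set.EqOn g f U) : Sm g := ContDiffOn.congr hf h

theorem Sm.diff {f} (hf : Sm f) {x} (hx : x ∈ U) : DifferentiableAt ℝ f x :=
  (hf.contDiffAt (U_open.mem_nhds hx)).differentiableAt (by simp)

theorem good_pd (i : Fin 3) : Good (pd i) where
  sm f hf := by
    have h := hf.fderiv_of_isOpen (m := (⊤ : ℕ∞)) U_open (by simp)
    exact h.clm_apply contDiffOn_const
  congr f g h x hx := by
    have : f =ᶠ[nhds x] g := Filter.eventuallyEq_of_mem (U_open.mem_nhds hx) h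
    simp only [pd, this.fderiv_eq]
  add f g hf hg x hx := by
    simp [pd, fderiv_add (hf.diff hx) (hg.diff hx)]
  smul c f hf x hx := by
    simp [pd, fderiv_const_smul (hf.diff hx)]
  mul f g hf hg x hx := by
    simp [pd, fderiv_mul (hf.diff hx) (hg.diff hx)]; ring

theorem LinOp.comp {D E} (hD : LinOp D) (hE : LinOp E) : LinOp (D ∘ E) where
  sm f hf := hD.sm _ (hE.sm _ hf)
  congr f g h := hD.congr _ _ (hE.congr _ _ h)
  add f g hf hg x hx := by
    have h1 := hD.congr _ _ (hE.add f g hf hg) hx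
    have h2 := hD.add _ _ (hE.sm f hf) (hE.sm g hg) hx
    exact h1.trans h2
  smul c f hf x hx := by
    have h1 := hD.congr _ _ (hE.smul c f hf) hx
    have h2 := hD.smul c _ (hE.sm f hf) hx
    exact h1.trans h2

theorem linop_id : LinOp id where
  sm f hf := hf
  congr f g h := h
  add f g hf hg x hx := rfl
  smul c f hf x hx := rfl

theorem LinOp.iter {D} (hD : LinOp D) (n : ℕ) : LinOp (D^[n]) := by
  induction n with
  | zero => exact linop_id
  | succ n ih => rw [Function.iterate_succ]; exact ih.comp hD

theorem LinOp.sum {D} (hD : LinOp D) {ι : Type} (s : Finset ι) (F : ι → R3 → ℝ)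
    (h : ∀ i ∈ s, Sm (F i)) : Set.EqOn (D (∑ i ∈ s, F i)) (∑ i ∈ s, D (F i)) U := by
  classical
  induction s using Finset.induction_on with
  | empty =>
    intro x hx
    have h0 : Sm (0 : R3 → ℝ) := by
      simpa using Sm.sum (∅ : Finset ι) F (by simp)
    have := hD.smul 0 0 h0 hx
    simpa using this
  | insert a s ha ih =>
    rw [Finset.sum_insert ha, Finset.sum_insert ha]
    intro x hx
    have hs : ∀ i ∈ s, Sm (F i) := fun i hi => h i (Finset.mem_insert_of_mem hi)
    rw [hD.add _ _ (h a (Finset.mem_insert_self _ _)) (Sm.sum s F hs) hx]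
    simp only [Pi.add_apply]
    rw [ih hs hx]

theorem LinOp.sum_smul {D} (hD : LinOp D) {ι : Type} (s : Finset ι) (c : ι → ℝ) (F : ι → R3 → ℝ)
    (h : ∀ i ∈ s, Sm (F i)) {x} (hx : x ∈ U) :
    D (∑ i ∈ s, c i • F i) x = ∑ i ∈ s, c i * D (F i) x := by
  rw [hD.sum s _ (fun i hi => (h i hi).smul _) hx, Finset.sum_apply]
  refine Finset.sum_congr rfl fun i hi => ?_
  rw [hD.smul _ _ (h i hi) hx]; simp

theorem Good.comb {D E} (hD : Good D) (hE : Good E) {a b} (ha : Sm a) (hb : Sm b) :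
    Good (fun f => a * D f + b * E f) where
  sm f hf := (ha.mul (hD.sm f hf)).add (hb.mul (hE.sm f hf))
  congr f g h x hx := by
    simp [hD.congr f g h hx, hE.congr f g h hx]
  add f g hf hg x hx := by
    simp [hD.add f g hf hg hx, hE.add f g hf hg hx]; ring
  smul c f hf x hx := by
    simp [hD.smul c f hf hx, hE.smul c f hf hx]; ring
  mul f g hf hg x hx := by
    simp [hD.mul f g hf hg hx, hE.mul f g hf hg hx]; ring

theorem Good.congrOp {D E : (R3 → ℝ) → (R3 → ℝ)} (hD : Good D) (h : ∀ f, Set.EqOn (E f) (D f) U) :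
    Good E where
  sm f hf := (hD.sm f hf).congr (h f)
  congr f g hfg x hx := by rw [h f hx, h g hx, hD.congr f g hfg hx]
  add f g hf hg x hx := by simp [h _ hx, hD.add f g hf hg hx]
  smul c f hf x hx := by simp [h _ hx, hD.smul c f hf hx]
  mul f g hf hg x hx := by simp [h _ hx, hD.mul f g hf hg hx]

/-- coordinate function -/
def X (i : Fin 3) : R3 → ℝ := fun x => x i

theorem sm_X (i) : Sm (X i) := by
  have : ContDiff ℝ (⊤ : ℕ∞) (X i) := by unfold X; fun_prop
  exact this.contDiffOn

theorem pd_X (i j) (x) : pd i (X j) x = if i = j then 1 else 0 := by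
  have : X j = (ContinuousLinearMap.proj j : R3 →L[ℝ] ℝ) := rfl
  simp only [pd, this, ContinuousLinearMap.fderiv]
  simp [Pi.single_apply, eq_comm]

theorem sm_rr : Sm rr := by
  unfold rr
  refine ContDiffOn.sqrt ?_ ?_
  · exact ContDiff.contDiffOn (by fun_prop)
  · intro x hx h
    have : 0 < rr x := hx
    simp [rr, h] at this

/-- reciprocal radius -/
def w : R3 → ℝ := fun x => (rr x)⁻¹

theorem sm_w : Sm w := ContDiffOn.inv sm_rr fun _ hx => ne_of_gt hx

theorem rr_sq (x : R3) : rr x * rr x = x 0 * x 0 + x 1 * x 1 := by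
  unfold rr
  rw [Real.mul_self_sqrt (by positivity)]; ring

theorem pd_rr (i) {x} (hx : x ∈ U) :
    rr x * pd i rr x = x 0 * (if i = 0 then 1 else 0) + x 1 * (if i = 1 then 1 else 0) := by
  have e : rr * rr = X 0 * X 0 + X 1 * X 1 := by
    ext y; simpa [X] using rr_sq y
  have h1 := (good_pd i).mul _ _ sm_rr sm_rr hx
  rw [e, (good_pd i).add _ _ ((sm_X 0).mul (sm_X 0)) ((sm_X 1).mul (sm_X 1)) hx] at h1
  simp only [Pi.add_apply, Pi.mul_apply] at h1
  rw [(good_pd i).mul _ _ (sm_X 0) (sm_X 0) hx, (good_pd i).mul _ _ (sm_X 1) (sm_X 1) hx] at h1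
  simp only [Pi.add_apply, Pi.mul_apply, pd_X] at h1
  simp only [X] at h1
  linarith

theorem pd_w (i) {x} (hx : x ∈ U) : pd i w x = - pd i rr x / (rr x) ^ 2 := by
  have hr : rr x ≠ 0 := ne_of_gt hx
  have h1 := (good_pd i).mul _ _ sm_w sm_rr hx
  have e : Set.EqOn (w * rr) (fun _ => 1) U := by
    intro y hy
    have hr : rr y ≠ 0 := ne_of_gt hy
    simp [w, hr]
  rw [(good_pd i).congr _ _ e hx] at h1
  have h2 : pd i (fun _ => (1:ℝ)) x = 0 := by simp [pd]
  rw [h2] at h1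
  simp only [Pi.add_apply, Pi.mul_apply] at h1
  have h3 : w x = 1 / rr x := by simp [w]
  rw [h3] at h1
  field_simp at h1 ⊢
  linarith

theorem good_dZ : Good dZ := good_pd 2

theorem good_dR : Good dR := by
  refine ((good_pd 0).comb (good_pd 1) ((sm_X 0).mul sm_w) ((sm_X 1).mul sm_w)).congrOp ?_
  intro f x hx
  simp [dR, X, w]; ring

theorem good_dRr : Good dRr := by
  refine (good_dR.comb good_dR sm_w ((sm_w).smul 0)).congrOp ?_
  intro f x hx
  simp [dRr, w]; ring

theorem pd_comm (i j) {f} (hf : Sm f) : Set.EqOn (pd i (pd j f)) (pd j (pd i f)) U := by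
  intro x hx
  have hc : ContDiffAt ℝ (⊤ : ℕ∞) f x := hf.contDiffAt (U_open.mem_nhds hx)
  have hs : IsSymmSndFDerivAt ℝ f x := hc.isSymmSndFDerivAt (by
    simp only [minSmoothness_of_isRCLikeNormedField]
    exact WithTop.coe_le_coe.2 (le_top : (2 : ℕ∞) ≤ ⊤))
  have hd : DifferentiableAt ℝ (fderiv ℝ f) x :=
    (hc.fderiv_right (m := (⊤ : ℕ∞)) (by simp)).differentiableAt (by simp)
  have key : ∀ a b : R3, fderiv ℝ (fun y => fderiv ℝ f y a) x b = fderiv ℝ (fderiv ℝ f) x b a := by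
    intro a b
    rw [fderiv_clm_apply hd (differentiableAt_const a)]
    simp
  unfold pd
  rw [key, key]
  exact hs _ _

theorem pd2_rr {x} (hx : x ∈ U) : pd 2 rr x = 0 := by
  have h := pd_rr 2 hx
  have hr : rr x ≠ 0 := ne_of_gt hx
  simpa [hr] using h

theorem dZ_w {x} (hx : x ∈ U) : dZ w x = 0 := by
  unfold dZ
  rw [pd_w 2 hx, pd2_rr hx]; simp

theorem dZ_X (i : Fin 3) (hi : i ≠ 2) (x) : dZ (X i) x = 0 := by
  unfold dZ
  rw [pd_X, if_neg hi.symm]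

theorem ZR {f} (hf : Sm f) : Set.EqOn (dZ (dR f)) (dR (dZ f)) U := by
  intro x hx
  have e : dR f = w * (X 0 * pd 0 f + X 1 * pd 1 f) := by
    ext y; simp [dR, w, X]; ring
  have s0 := (good_pd 0).sm f hf
  have s1 := (good_pd 1).sm f hf
  rw [e, good_dZ.mul _ _ sm_w (((sm_X 0).mul s0).add ((sm_X 1).mul s1)) hx]
  simp only [Pi.add_apply, Pi.mul_apply]
  rw [good_dZ.add _ _ ((sm_X 0).mul s0) ((sm_X 1).mul s1) hx]
  simp only [Pi.add_apply, Pi.mul_apply]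
  rw [good_dZ.mul _ _ (sm_X 0) s0 hx, good_dZ.mul _ _ (sm_X 1) s1 hx]
  simp only [Pi.add_apply, Pi.mul_apply]
  rw [dZ_w hx, dZ_X 0 (by decide), dZ_X 1 (by decide)]
  have c0 := pd_comm 2 0 hf hx
  have c1 := pd_comm 2 1 hf hx
  unfold dZ dR
  rw [c0, c1]
  simp [w, X]; ring

theorem ZA {f} (hf : Sm f) : Set.EqOn (dZ (dRr f)) (dRr (dZ f)) U := by
  intro x hx
  have e : dRr f = w * dR f := by
    ext y; simp [dRr, w]; ring
  rw [e, good_dZ.mul _ _ sm_w (good_dR.sm f hf) hx]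
  simp only [Pi.add_apply, Pi.mul_apply]
  rw [dZ_w hx, ZR hf hx]
  simp [dRr, w]; ring

theorem comm_iter {D E} (hD : LinOp D) (hE : LinOp E)
    (h : ∀ f, Sm f → Set.EqOn (D (E f)) (E (D f)) U) (n : ℕ) :
    ∀ f, Sm f → Set.EqOn (D (E^[n] f)) (E^[n] (D f)) U := by
  induction n with
  | zero => intro f hf x hx; rfl
  | succ n ih =>
    intro f hf x hx
    rw [Function.iterate_succ_apply, Function.iterate_succ_apply, ih _ (hE.sm f hf) hx]
    exact (hE.iter n).congr _ _ (h f hf) hx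

theorem leibniz {D} (hD : Good D) (n : ℕ) : ∀ f g, Sm f → Sm g → ∀ x ∈ U,
    D^[n] (f * g) x = ∑ k ∈ Finset.range (n + 1), (n.choose k : ℝ) * (D^[k] f x * D^[n - k] g x) := by
  induction n with
  | zero => intro f g hf hg x hx; simp
  | succ n ih =>
    intro f g hf hg x hx
    have hn := hD.toLinOp.iter n
    have sf := hD.sm f hf
    have sg := hD.sm g hg
    rw [Function.iterate_succ_apply, hn.congr _ _ (hD.mul f g hf hg) hx,
      hn.add _ _ (sf.mul hg) (hf.mul sg) hx]
    simp only [Pi.add_apply]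
    rw [ih _ _ sf hg x hx, ih _ _ hf sg x hx]
    rw [Finset.sum_choose_succ_mul (fun a b => D^[a] f x * D^[b] g x) n, add_comm]
    congr 1
    refine Finset.sum_congr rfl fun k hk => ?_
    have hk' : k ≤ n := by simpa [Nat.lt_succ_iff] using hk
    rw [Nat.succ_sub hk', Function.iterate_succ_apply]

theorem leibniz_fun {D} (hD : Good D) (n : ℕ) (f g) (hf : Sm f) (hg : Sm g) :
    Set.EqOn (D^[n] (f * g))
      (∑ k ∈ Finset.range (n + 1), (n.choose k : ℝ) • (D^[k] f * D^[n - k] g)) U := by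
  intro x hx
  rw [leibniz hD n f g hf hg x hx]
  simp [Finset.sum_apply]

theorem leibniz2 {D E} (hD : Good D) (hE : Good E) (m n : ℕ) (f g) (hf : Sm f) (hg : Sm g)
    {x} (hx : x ∈ U) :
    E^[m] (D^[n] (f * g)) x = ∑ p ∈ Finset.range (n + 1) ×ˢ Finset.range (m + 1),
      (n.choose p.1 : ℝ) * (m.choose p.2) *
        (E^[p.2] (D^[p.1] f) x * E^[m - p.2] (D^[n - p.1] g) x) := by
  have hm := hE.toLinOp.iter m
  have sf := fun k => (hD.toLinOp.iter k).sm f hf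
  have sg := fun k => (hD.toLinOp.iter k).sm g hg
  rw [hm.congr _ _ (leibniz_fun hD n f g hf hg) hx,
    hm.sum_smul _ _ _ (fun k _ => (sf k).mul (sg _)) hx, Finset.sum_product]
  refine Finset.sum_congr rfl fun k _ => ?_
  rw [leibniz hE m _ _ (sf k) (sg _) x hx, Finset.mul_sum]
  refine Finset.sum_congr rfl fun j _ => ?_
  ring

theorem dR_rr {x} (hx : x ∈ U) : dR rr x = 1 := by
  have h0 := pd_rr 0 hx
  have h1 := pd_rr 1 hx
  have hr : rr x ≠ 0 := ne_of_gt hx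
  have h2 := rr_sq x
  simp at h0 h1
  unfold dR
  rw [div_eq_one_iff_eq hr]
  apply mul_left_cancel₀ hr
  linear_combination x 0 * h0 + x 1 * h1 - h2

theorem AR {f} (hf : Sm f) {x} (hx : x ∈ U) :
    dRr (dR f) x = dRr f x / rr x + dR (dRr f) x := by
  have hr : rr x ≠ 0 := ne_of_gt hx
  have e : Set.EqOn (dR f) (rr * dRr f) U := by
    intro y hy
    have hr : rr y ≠ 0 := ne_of_gt hy
    simp [dRr]; field_simp
  rw [good_dRr.congr _ _ e hx, good_dRr.mul _ _ sm_rr (good_dRr.sm f hf) hx]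
  simp only [Pi.add_apply, Pi.mul_apply]
  have : dRr rr x = 1 / rr x := by unfold dRr; rw [dR_rr hx]
  rw [this]
  have : dRr (dRr f) x = dR (dRr f) x / rr x := rfl
  rw [this]
  field_simp

/-- key step, from `∂_r v + v / r + g = 0` -/
theorem stepA {v g f} (hv : Sm v) (hdiv : ∀ x ∈ U, dR v x + v x / rr x + g x = 0)
    (hf : Sm f) : Set.EqOn (dRr (v * dR f)) (v * dR (dRr f) + (-1 : ℝ) • (g * dRr f)) U := by
  intro x hx
  have hr : rr x ≠ 0 := ne_of_gt hx
  rw [good_dRr.mul _ _ hv (good_dR.sm f hf) hx]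
  simp only [Pi.add_apply, Pi.mul_apply, Pi.smul_apply, smul_eq_mul]
  rw [AR hf hx]
  have h := hdiv x hx
  have e1 : dRr v x = dR v x / rr x := rfl
  have e2 : dR f x = rr x * dRr f x := by simp [dRr]; field_simp
  rw [e1, e2]
  have : dR v x = - (v x / rr x) - g x := by linarith
  rw [this]
  field_simp
  ring

theorem iterA {v g} (hv : Sm v) (hg : Sm g) (hdiv : ∀ x ∈ U, dR v x + v x / rr x + g x = 0)
    (m : ℕ) : ∀ f, Sm f → ∀ x ∈ U, dRr^[m] (v * dR f) x = v x * dR (dRr^[m] f) x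
      + ∑ j ∈ Finset.range (m + 1),
        (-(m.choose (j + 1) : ℝ)) * (dRr^[j] g x * dRr^[m - j] f x) := by
  induction m with
  | zero => intro f hf x hx; simp
  | succ m ih =>
    intro f hf x hx
    have hm := good_dRr.toLinOp.iter m
    have sa := good_dRr.sm f hf
    rw [Function.iterate_succ_apply, hm.congr _ _ (stepA hv hdiv hf) hx,
      hm.add _ _ (hv.mul (good_dR.sm _ sa)) ((hg.mul sa).smul _) hx]
    simp only [Pi.add_apply]
    rw [hm.smul _ _ (hg.mul sa) hx, ih _ sa x hx]
    simp only [Pi.smul_apply, smul_eq_mul]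
    rw [leibniz good_dRr m _ _ hg sa x hx, add_assoc, Finset.mul_sum, ← Finset.sum_add_distrib,
      Finset.sum_range_succ _ (m + 1)]
    rw [Nat.choose_eq_zero_of_lt (show m + 1 < m + 1 + 1 by omega)]
    simp only [Nat.cast_zero, neg_zero, zero_mul, add_zero]
    rw [← Function.iterate_succ_apply]
    congr 1
    refine Finset.sum_congr rfl fun k hk => ?_
    have hk' : k ≤ m := by simpa [Nat.lt_succ_iff] using hk
    rw [Nat.succ_sub hk', Function.iterate_succ_apply, Nat.choose_succ_succ]
    push_cast
    ring

theorem sm_comp {u : R3 → R3} (hu : ContDiff ℝ (⊤ : ℕ∞) u) (i) : Sm (fun y => u y i) :=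
  ((contDiff_apply ℝ ℝ i).comp hu).contDiffOn

theorem compR_eq (u) : compR u = w * (X 0 * (fun y => u y 0) + X 1 * (fun y => u y 1)) := by
  ext y; simp [compR, dot, er, Fin.sum_univ_three, w, X]; ring

theorem compTh_eq (u) :
    compTh u = w * (X 0 * (fun y => u y 1) + (-1 : ℝ) • (X 1 * (fun y => u y 0))) := by
  ext y; simp [compTh, dot, etheta, Fin.sum_univ_three, w, X]; ring

theorem compZ_eq (u) : compZ u = fun y => u y 2 := by
  ext y; simp [compZ, dot, ez, Fin.sum_univ_three]

theorem sm_compR {u : R3 → R3} (hu : ContDiff ℝ (⊤ : ℕ∞) u) : Sm (compR u) := by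
  rw [compR_eq]
  exact sm_w.mul (((sm_X 0).mul (sm_comp hu 0)).add ((sm_X 1).mul (sm_comp hu 1)))

theorem sm_compTh {u : R3 → R3} (hu : ContDiff ℝ (⊤ : ℕ∞) u) : Sm (compTh u) := by
  rw [compTh_eq]
  exact sm_w.mul (((sm_X 0).mul (sm_comp hu 1)).add (((sm_X 1).mul (sm_comp hu 0)).smul _))

theorem pd_compR {u : R3 → R3} (hu : ContDiff ℝ (⊤ : ℕ∞) u) (i) {x} (hx : x ∈ U) :
    pd i (compR u) x = pd i w x * (x 0 * u x 0 + x 1 * u x 1)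
      + (rr x)⁻¹ * ((if i = 0 then 1 else 0) * u x 0 + x 0 * pd i (fun y => u y 0) x
        + ((if i = 1 then 1 else 0) * u x 1 + x 1 * pd i (fun y => u y 1) x)) := by
  have a := (sm_X 0).mul (sm_comp hu 0)
  have b := (sm_X 1).mul (sm_comp hu 1)
  rw [compR_eq, (good_pd i).mul _ _ sm_w (a.add b) hx]
  simp only [Pi.add_apply, Pi.mul_apply]
  rw [(good_pd i).add _ _ a b hx]
  simp only [Pi.add_apply, Pi.mul_apply]
  rw [(good_pd i).mul _ _ (sm_X 0) (sm_comp hu 0) hx,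
    (good_pd i).mul _ _ (sm_X 1) (sm_comp hu 1) hx]
  simp only [Pi.add_apply, Pi.mul_apply, pd_X]
  simp only [X, w]

theorem pd_compTh {u : R3 → R3} (hu : ContDiff ℝ (⊤ : ℕ∞) u) (i) {x} (hx : x ∈ U) :
    pd i (compTh u) x = pd i w x * (x 0 * u x 1 - x 1 * u x 0)
      + (rr x)⁻¹ * ((if i = 0 then 1 else 0) * u x 1 + x 0 * pd i (fun y => u y 1) x
        - ((if i = 1 then 1 else 0) * u x 0 + x 1 * pd i (fun y => u y 0) x)) := by
  have a := (sm_X 0).mul (sm_comp hu 1)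
  have b := (sm_X 1).mul (sm_comp hu 0)
  rw [compTh_eq, (good_pd i).mul _ _ sm_w (a.add (b.smul _)) hx]
  simp only [Pi.add_apply, Pi.mul_apply]
  rw [(good_pd i).add _ _ a (b.smul _) hx]
  simp only [Pi.add_apply, Pi.mul_apply]
  rw [(good_pd i).smul _ _ b hx]
  simp only [Pi.smul_apply, smul_eq_mul]
  rw [(good_pd i).mul _ _ (sm_X 0) (sm_comp hu 1) hx,
    (good_pd i).mul _ _ (sm_X 1) (sm_comp hu 0) hx]
  simp only [Pi.add_apply, Pi.mul_apply, pd_X]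
  simp only [X, w]
  ring

/-- `(1/r)∂_θ u_θ + ∂_z u_z` -/
def gg (u : R3 → R3) : R3 → ℝ := fun y => dTheta (compTh u) y / rr y + dZ (compZ u) y

theorem sm_gg {u : R3 → R3} (hu : ContDiff ℝ (⊤ : ℕ∞) u) : Sm (gg u) := by
  have e : gg u = w * (X 0 * pd 1 (compTh u) + (-1 : ℝ) • (X 1 * pd 0 (compTh u)))
      + dZ (compZ u) := by
    ext y; simp [gg, dTheta, w, X]; ring
  rw [e]
  have h := sm_compTh hu
  refine (sm_w.mul (((sm_X 0).mul ((good_pd 1).sm _ h)).add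
    (((sm_X 1).mul ((good_pd 0).sm _ h)).smul _))).add (good_dZ.sm _ ?_)
  rw [compZ_eq]; exact sm_comp hu 2

theorem div_cyl {u : R3 → R3} (hu : ContDiff ℝ (⊤ : ℕ∞) u) (hd : divFree u) :
    ∀ x ∈ U, dR (compR u) x + compR u x / rr x + gg u x = 0 := by
  intro x hx
  have hr : rr x ≠ 0 := ne_of_gt hx
  have h0 := pd_rr 0 hx
  have h1 := pd_rr 1 hx
  have h2 := rr_sq x
  have hD := hd x
  simp only [Fin.sum_univ_three] at hD
  simp at h0 h1
  have e0 : pd 0 rr x = x 0 / rr x := by field_simp; linarith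
  have e1 : pd 1 rr x = x 1 / rr x := by field_simp; linarith
  unfold gg dTheta dR
  rw [pd_compTh hu 0 hx, pd_compTh hu 1 hx, pd_compR hu 0 hx, pd_compR hu 1 hx, pd_w 0 hx,
    pd_w 1 hx, e0, e1, compR_eq, compZ_eq]
  simp only [X, w, dZ, Pi.mul_apply, Pi.add_apply]
  have e2 : pd 2 (fun y => u y 2) x = - pd 0 (fun y => u y 0) x - pd 1 (fun y => u y 1) x := by
    linarith
  rw [e2]
  simp
  generalize pd 0 (fun y => u y 0) x = a00
  generalize pd 0 (fun y => u y 1) x = a01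
  generalize pd 1 (fun y => u y 0) x = a10
  generalize pd 1 (fun y => u y 1) x = a11
  generalize u x 0 = u0 at *
  generalize u x 1 = u1 at *
  generalize x 0 = p at *
  generalize x 1 = q at *
  generalize rr x = r at *
  field_simp
  have h3 : r ^ 2 = p ^ 2 + q ^ 2 := by linarith
  simp only [show r ^ 4 = (r ^ 2) ^ 2 by ring, h3]
  ring

/-- the commutator `[𝒟^𝔐, u_r∂_r + u_z∂_z]f` expands with integer
coefficients for all smooth divergence-free `u` and smooth axisymmetric `f`. -/
theorem stmt_11 (mc mr mz : ℕ) :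
    ∃ (C2 : ℕ × ℕ × ℕ → ℤ) (C3 : ℕ × ℕ × ℕ → ℤ) (C4 : ℕ × ℕ → ℤ),
      ∀ u : R3 → R3, ContDiff ℝ (⊤ : ℕ∞) u → divFree u →
        ∀ f : R3 → ℝ, ContDiff ℝ (⊤ : ℕ∞) f → axisym f → ∀ x ∈ U,
          Dop mc mr mz (fun y => compR u y * dR f y + compZ u y * dZ f y) x
            - (compR u x * dR (Dop mc mr mz f) x + compZ u x * dZ (Dop mc mr mz f) x)
          = (∑ p ∈ idx1 mc mr mz,
                (C2 p : ℝ) * Dop p.1 p.2.1 p.2.2 (compZ u) x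
                  * Dop (mc - p.1) (mr - p.2.1) (mz - p.2.2) (dZ f) x)
            + (∑ p ∈ idx2 mc mr mz,
                (C3 p : ℝ)
                  * Dop p.1 p.2.1 p.2.2
                      (fun y => dTheta (compTh u) y / rr y + dZ (compZ u) y) x
                  * Dop (mc - p.1) (mr - p.2.1) (mz - p.2.2) f x)
            + (∑ p ∈ idx3 mr mz,
                (C4 p : ℝ) * dZ^[p.2] (dR^[p.1] (compR u)) x
                  * dR (Dop mc (mr - p.1) (mz - p.2) f) x) := by
  classical
  refine ⟨fun p => mc.choose p.1 * mr.choose p.2.1 * mz.choose p.2.2,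
    fun p => -(mc.choose (p.1 + 1) * mr.choose p.2.1 * mz.choose p.2.2),
    fun p => mr.choose p.1 * mz.choose p.2, ?_⟩
  intro u hu hd f hf' _ x hx
  have hf : Sm f := hf'.contDiffOn
  have hv := sm_compR hu
  have hz : Sm (compZ u) := by rw [compZ_eq]; exact sm_comp hu 2
  have hg := sm_gg hu
  have hZf := good_dZ.sm f hf
  have hRf := good_dR.sm f hf
  have iA := fun n => good_dRr.toLinOp.iter n
  have iR := fun n => good_dR.toLinOp.iter n
  have iZ := fun n => good_dZ.toLinOp.iter n
  have hT : LinOp (dZ^[mz] ∘ dR^[mr]) := (iZ mz).comp (iR mr)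
  -- step 1
  have s1 := hv.mul (good_dR.sm _ ((iA mc).sm f hf))
  have sF2 : ∀ j ∈ Finset.range (mc + 1),
      Sm (dRr^[j] (compZ u) * dRr^[mc - j] (dZ f)) :=
    fun j _ => ((iA j).sm _ hz).mul ((iA _).sm _ hZf)
  have sF3 : ∀ j ∈ Finset.range (mc + 1),
      Sm (dRr^[j] (gg u) * dRr^[mc - j] f) :=
    fun j _ => ((iA j).sm _ hg).mul ((iA _).sm _ hf)
  have s2 := Sm.sum (Finset.range (mc + 1)) _
    (fun j hj => (sF2 j hj).smul (mc.choose j : ℝ))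
  have s3 := Sm.sum (Finset.range (mc + 1)) _
    (fun j hj => (sF3 j hj).smul (-(mc.choose (j + 1) : ℝ)))
  have e1 : Set.EqOn (dRr^[mc] (fun y => compR u y * dR f y + compZ u y * dZ f y))
      ((compR u * dR (dRr^[mc] f)
        + ∑ j ∈ Finset.range (mc + 1),
          (mc.choose j : ℝ) • (dRr^[j] (compZ u) * dRr^[mc - j] (dZ f)))
        + ∑ j ∈ Finset.range (mc + 1),
          (-(mc.choose (j + 1) : ℝ)) • (dRr^[j] (gg u) * dRr^[mc - j] f)) U := by
    intro y hy
    have := (iA mc).add _ _ (hv.mul hRf) (hz.mul hZf) hy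
    refine Eq.trans this ?_
    simp only [Pi.add_apply]
    rw [iterA hv hg (div_cyl hu hd) mc f hf y hy, leibniz good_dRr mc _ _ hz hZf y hy]
    simp only [Finset.sum_apply, Pi.smul_apply, Pi.mul_apply, smul_eq_mul]
    ring
  have e2 : Dop mc mr mz (fun y => compR u y * dR f y + compZ u y * dZ f y) x
      = (dZ^[mz] ∘ dR^[mr]) (compR u * dR (dRr^[mc] f)) x
        + ∑ j ∈ Finset.range (mc + 1), (mc.choose j : ℝ) *
          (dZ^[mz] ∘ dR^[mr]) (dRr^[j] (compZ u) * dRr^[mc - j] (dZ f)) x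
        + ∑ j ∈ Finset.range (mc + 1), (-(mc.choose (j + 1) : ℝ)) *
          (dZ^[mz] ∘ dR^[mr]) (dRr^[j] (gg u) * dRr^[mc - j] f) x := by
    have := hT.congr _ _ e1 hx
    refine Eq.trans this ?_
    rw [hT.add _ _ (s1.add s2) s3 hx]
    simp only [Pi.add_apply]
    rw [hT.add _ _ s1 s2 hx]
    simp only [Pi.add_apply]
    rw [hT.sum_smul _ _ _ sF2 hx, hT.sum_smul _ _ _ sF3 hx]
  -- the three pieces
  have p1 : (dZ^[mz] ∘ dR^[mr]) (compR u * dR (dRr^[mc] f)) x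
      = ∑ p ∈ Finset.range (mr + 1) ×ˢ Finset.range (mz + 1),
        ((mr.choose p.1 : ℝ) * mz.choose p.2) * dZ^[p.2] (dR^[p.1] (compR u)) x
                  * dR (Dop mc (mr - p.1) (mz - p.2) f) x := by
    have hA := (iA mc).sm f hf
    refine (leibniz2 good_dR good_dZ mz mr _ _ hv (good_dR.sm _ hA) hx).trans ?_
    refine Finset.sum_congr rfl fun p _ => ?_
    have c := comm_iter good_dR.toLinOp good_dZ.toLinOp (fun f hf => (ZR hf).symm) (mz - p.2)
      _ ((iR (mr - p.1)).sm _ hA) hx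
    unfold Dop
    rw [c, ← Function.iterate_succ_apply dR, Function.iterate_succ_apply' dR]
    ring
  have p2 : ∑ j ∈ Finset.range (mc + 1), (mc.choose j : ℝ) *
          (dZ^[mz] ∘ dR^[mr]) (dRr^[j] (compZ u) * dRr^[mc - j] (dZ f)) x
      = ∑ p ∈ Finset.range (mc + 1) ×ˢ Finset.range (mr + 1) ×ˢ Finset.range (mz + 1),
        ((mc.choose p.1 : ℝ) * mr.choose p.2.1 * mz.choose p.2.2)
          * Dop p.1 p.2.1 p.2.2 (compZ u) x
                  * Dop (mc - p.1) (mr - p.2.1) (mz - p.2.2) (dZ f) x := by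
    rw [Finset.sum_product]
    refine Finset.sum_congr rfl fun j _ => ?_
    have := leibniz2 good_dR good_dZ mz mr _ _ ((iA j).sm _ hz) ((iA (mc - j)).sm _ hZf) hx
    rw [Function.comp_apply, this, Finset.mul_sum]
    refine Finset.sum_congr rfl fun p _ => ?_
    simp only [Dop]; ring
  have p3 : ∑ j ∈ Finset.range (mc + 1), (-(mc.choose (j + 1) : ℝ)) *
          (dZ^[mz] ∘ dR^[mr]) (dRr^[j] (gg u) * dRr^[mc - j] f) x
      = ∑ p ∈ Finset.range (mc + 1) ×ˢ Finset.range (mr + 1) ×ˢ Finset.range (mz + 1),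
        (-((mc.choose (p.1 + 1) : ℝ) * mr.choose p.2.1 * mz.choose p.2.2))
          * Dop p.1 p.2.1 p.2.2 (gg u) x
                  * Dop (mc - p.1) (mr - p.2.1) (mz - p.2.2) f x := by
    rw [Finset.sum_product]
    refine Finset.sum_congr rfl fun j _ => ?_
    have := leibniz2 good_dR good_dZ mz mr _ _ ((iA j).sm _ hg) ((iA (mc - j)).sm _ hf) hx
    rw [Function.comp_apply, this, Finset.mul_sum]
    refine Finset.sum_congr rfl fun p _ => ?_
    simp only [Dop]; ring
  -- commutation of `∂_z` with everything
  have cZ : dZ (Dop mc mr mz f) x = Dop mc mr mz (dZ f) x := by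
    have hA := (iA mc).sm f hf
    have c1 : dZ (Dop mc mr mz f) = dZ^[mz] (dZ (dR^[mr] (dRr^[mc] f))) := by
      unfold Dop
      exact (Function.iterate_succ_apply' dZ mz _).symm.trans (Function.iterate_succ_apply dZ mz _)
    rw [c1]
    refine (iZ mz).congr _ _ ?_ hx
    refine (comm_iter good_dZ.toLinOp good_dR.toLinOp (fun f hf => ZR hf) mr _ hA).trans ?_
    exact (iR mr).congr _ _
      (comm_iter good_dZ.toLinOp good_dRr.toLinOp (fun f hf => ZA hf) mc _ hf)
  -- index sets
  rw [e2, p1, p2, p3, cZ]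
  have q1 : Finset.range (mc + 1) ×ˢ Finset.range (mr + 1) ×ˢ Finset.range (mz + 1)
      = insert (0, 0, 0) (idx1 mc mr mz) := by
    ext ⟨a, b, c⟩
    simp only [idx1, Finset.mem_insert, Finset.mem_filter, Finset.mem_product, Finset.mem_range,
      Prod.mk.injEq]
    omega
  have n1 : (0, 0, 0) ∉ idx1 mc mr mz := by simp [idx1]
  have q3 : Finset.range (mr + 1) ×ˢ Finset.range (mz + 1) = insert (0, 0) (idx3 mr mz) := by
    ext ⟨a, b⟩
    simp only [idx3, Finset.mem_insert, Finset.mem_filter, Finset.mem_product, Finset.mem_range,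
      Prod.mk.injEq]
    omega
  have n3 : (0, 0) ∉ idx3 mr mz := by simp [idx3]
  have q2 : ∀ F G : ℕ × ℕ × ℕ → ℝ,
      ∑ p ∈ Finset.range (mc + 1) ×ˢ Finset.range (mr + 1) ×ˢ Finset.range (mz + 1),
        (-((mc.choose (p.1 + 1) : ℝ) * mr.choose p.2.1 * mz.choose p.2.2)) * F p * G p
      = ∑ p ∈ idx2 mc mr mz,
        (-((mc.choose (p.1 + 1) : ℝ) * mr.choose p.2.1 * mz.choose p.2.2)) * F p * G p := by
    intro F G
    symm
    refine Finset.sum_subset (Finset.filter_subset _ _) ?_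
    rintro ⟨a, b, c⟩ h1 h2
    simp only [idx2, Finset.mem_filter, Finset.mem_product, Finset.mem_range] at h1 h2
    have : mc < a + 1 := by omega
    simp [Nat.choose_eq_zero_of_lt this]
  rw [q2, q1, Finset.sum_insert n1, q3, Finset.sum_insert n3]
  have t1 : Dop 0 0 0 (compZ u) x = compZ u x := rfl
  simp only [t1, Nat.choose_zero_right, Nat.cast_one, Nat.sub_zero, Function.iterate_zero, id]
  push_cast
  unfold gg
  ring
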